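/- Every log-concave probability measure μ on ℝ^n satisfies C_P(μ) ≤ 32 · 81 · ln(2) · μ(|x − μ(x)|²), where μ(x) denotes the mean of μ. -/

import Mathlib

open MeasureTheory Real Set
open scoped ENNReal RealInnerProductSpace Pointwise Matrix

noncomputable section

/-- Euclidean space ℝ^n. -/
abbrev En (n : ℕ) := EuclideanSpace ℝ (Fin n)

/-- Test functions: smooth, bounded and Lipschitz. -/
def IsTestFun {n : ℕ} (f : En n → ℝ) : Prop :=
  ContDiff ℝ (⊤ : ℕ∞) f ∧ (∃ M, ∀ x, |f x| ≤ M) ∧ ∃ L, LipschitzWith L f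

/-- `μ` satisfies a Poincaré inequality with constant `C`. -/
def PoincareLE {n : ℕ} (μ : Measure (En n)) (C : ℝ) : Prop :=
  ∀ f : En n → ℝ, IsTestFun f →
    (∫ x, (f x) ^ 2 ∂μ) - (∫ x, f x ∂μ) ^ 2 ≤ C * ∫ x, ‖gradient f x‖ ^ 2 ∂μ

/-- `μ` satisfies a logarithmic Sobolev inequality with constant `C`. -/
def LogSobolevLE {n : ℕ} (μ : Measure (En n)) (C : ℝ) : Prop :=
  ∀ f : En n → ℝ, IsTestFun f →
    (∫ x, (f x) ^ 2 * Real.log ((f x) ^ 2) ∂μ)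
        - (∫ x, (f x) ^ 2 ∂μ) * Real.log (∫ x, (f x) ^ 2 ∂μ)
      ≤ C * ∫ x, ‖gradient f x‖ ^ 2 ∂μ

/-- `μ` satisfies an L¹-Poincaré inequality (around the mean) with constant `C`. -/
def CheegerMeanLE {n : ℕ} (μ : Measure (En n)) (C : ℝ) : Prop :=
  ∀ f : En n → ℝ, IsTestFun f →
    ∫ x, |f x - ∫ y, f y ∂μ| ∂μ ≤ C * ∫ x, ‖gradient f x‖ ∂μ

/-- `m` is a median of `f` under `μ`. -/
def IsMedian {n : ℕ} (μ : Measure (En n)) (f : En n → ℝ) (m : ℝ) : Prop :=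
  ENNReal.ofReal (1 / 2) ≤ μ {x | f x ≤ m} ∧ ENNReal.ofReal (1 / 2) ≤ μ {x | m ≤ f x}

/-- `μ` satisfies a Cheeger inequality (around medians) with constant `C`. -/
def CheegerMedianLE {n : ℕ} (μ : Measure (En n)) (C : ℝ) : Prop :=
  ∀ f : En n → ℝ, IsTestFun f → ∀ m : ℝ, IsMedian μ f m →
    ∫ x, |f x - m| ∂μ ≤ C * ∫ x, ‖gradient f x‖ ∂μ

/-- The perturbed (normalized) measure `μ_F = Z_F⁻¹ e^{-F} μ`. -/
def perturb {n : ℕ} (μ : Measure (En n)) (F : En n → ℝ) : Measure (En n) :=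
  (ENNReal.ofReal (∫ x, Real.exp (-F x) ∂μ))⁻¹ •
    μ.withDensity fun x => ENNReal.ofReal (Real.exp (-F x))

/-- Topological support of a measure. -/
def measSupport {n : ℕ} (μ : Measure (En n)) : Set (En n) :=
  {x | ∀ U ∈ nhds x, 0 < μ U}

/-- `μ` is log-concave: it has density `e^{-W}` on a convex set, with `W` convex
(equivalently, density `e^{-W}` with `W : ℝⁿ → ℝ ∪ {+∞}` convex). -/
def IsLogConcave {n : ℕ} (μ : Measure (En n)) : Prop :=
  ∃ (s : Set (En n)) (W : En n → ℝ), Convex ℝ s ∧ ConvexOn ℝ s W ∧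
    μ = volume.withDensity (s.indicator fun x => ENNReal.ofReal (Real.exp (-W x)))

/-- The Laplacian of `F`. -/
def laplacian {n : ℕ} (F : En n → ℝ) (x : En n) : ℝ :=
  ∑ i : Fin n,
    fderiv ℝ (fun y => fderiv ℝ F y (EuclideanSpace.single i (1 : ℝ))) x
      (EuclideanSpace.single i (1 : ℝ))

/-- The generator `A F = ΔF - ∇V·∇F` associated with `μ = e^{-V} dx`. -/
def genA {n : ℕ} (V F : En n → ℝ) (x : En n) : ℝ :=
  laplacian F x - ⟪gradient V x, gradient F x⟫

/-- The centered Gaussian measure on ℝ^n with covariance matrix `σ² Id`. -/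
def gaussMeasure (n : ℕ) (σ : ℝ) : Measure (En n) :=
  volume.withDensity fun x =>
    ENNReal.ofReal ((2 * π * σ ^ 2) ^ (-(n : ℝ) / 2) * Real.exp (-‖x‖ ^ 2 / (2 * σ ^ 2)))

/-- Convolution of two measures. -/
def mconv {n : ℕ} (μ ν : Measure (En n)) : Measure (En n) :=
  (μ.prod ν).map fun p => p.1 + p.2

/-- Concentration profile of `μ`. -/
def concProfile {n : ℕ} (μ : Measure (En n)) (r : ℝ) : ℝ :=
  sSup {t | ∃ A : Set (En n), MeasurableSet A ∧ (1 : ℝ) / 2 ≤ (μ A).toReal ∧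
    t = 1 - (μ (A + Metric.ball (0 : En n) r)).toReal}

/-- Generalized inverse of the concentration profile. -/
def concInv {n : ℕ} (μ : Measure (En n)) (s : ℝ) : ℝ :=
  sInf {r | 0 < r ∧ concProfile μ r ≤ s}

/-- The Hessian matrix of `V` at `x`. -/
def hessMat {n : ℕ} (V : En n → ℝ) (x : En n) : Matrix (Fin n) (Fin n) ℝ :=
  fun i j =>
    fderiv ℝ (fun y => fderiv ℝ V y (EuclideanSpace.single j (1 : ℝ))) x
      (EuclideanSpace.single i (1 : ℝ))

end

/-- The one-dimensional Brunn–Minkowski inequality. -/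
lemma volume_add_volume_le {A B C : Set ℝ} (hA : MeasurableSet A) (hB : MeasurableSet B)
    (hA' : A.Nonempty) (hB' : B.Nonempty) (h : ∀ a ∈ A, ∀ b ∈ B, a + b ∈ C) :
    volume A + volume B ≤ volume C := by
  have key : ∀ K ⊆ A, ∀ L ⊆ B, IsCompact K → IsCompact L → K.Nonempty → L.Nonempty →
      volume K + volume L ≤ volume C := by
    intro K hKA L hLB hK hL hK0 hL0
    have hM := hK.sSup_mem hK0
    have hm := hL.sInf_mem hL0
    have hd : AEDisjoint volume ((fun x => x + sInf L) '' K) ((fun x => sSup K + x) '' L) := by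
      refine measure_mono_null (t := {sSup K + sInf L}) ?_ (by simp)
      rintro x ⟨⟨k, hk, rfl⟩, ⟨l, hl, hkl⟩⟩
      have h1 := le_csSup hK.bddAbove hk
      have h2 := csInf_le hL.bddBelow hl
      simp only [mem_singleton_iff] at *
      linarith
    have hLm : MeasurableSet ((fun x => sSup K + x) '' L) :=
      (hL.image (by fun_prop)).measurableSet
    calc volume K + volume L
        = volume ((fun x => x + sInf L) '' K) + volume ((fun x => sSup K + x) '' L) := by
          simp
      _ = volume (((fun x => x + sInf L) '' K) ∪ ((fun x => sSup K + x) '' L)) :=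
          (measure_union₀ hLm.nullMeasurableSet hd).symm
      _ ≤ volume C := by
          refine measure_mono (union_subset ?_ ?_)
          · rintro _ ⟨k, hk, rfl⟩
            exact h _ (hKA hk) _ (hLB hm)
          · rintro _ ⟨l, hl, rfl⟩
            exact h _ (hKA hM) _ (hLB hl)
  obtain ⟨a, ha⟩ := hA'
  obtain ⟨b, hb⟩ := hB'
  have key2 : ∀ K ⊆ A, ∀ L ⊆ B, IsCompact K → IsCompact L →
      volume K + volume L ≤ volume C := fun K hKA L hLB hK hL =>
    (add_le_add (measure_mono (subset_insert a K)) (measure_mono (subset_insert b L))).trans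
      (key _ (insert_subset ha hKA) _ (insert_subset hb hLB) (hK.insert a) (hL.insert b)
        (insert_nonempty _ _) (insert_nonempty _ _))
  rw [hA.measure_eq_iSup_isCompact volume, hB.measure_eq_iSup_isCompact volume]
  simp only [iSup_and']
  exact ENNReal.biSup_add_biSup_le' ⟨∅, empty_subset _, isCompact_empty⟩
    ⟨∅, empty_subset _, isCompact_empty⟩ fun K hK L hL => key2 K hK.1 L hL.1 hK.2 hL.2

/-- Weighted arithmetic mean–geometric mean inequality in `ℝ≥0∞`. -/
lemma ENNReal.rpow_mul_rpow_le_add (a b : ℝ≥0∞) {t : ℝ} (h0 : 0 < t) (h1 : t < 1) :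
    a ^ (1 - t) * b ^ t ≤ ENNReal.ofReal (1 - t) * a + ENNReal.ofReal t * b := by
  have h1' : 0 < 1 - t := by linarith
  have hpq : ((1 - t)⁻¹).HolderConjugate (t⁻¹) := by
    rw [Real.holderConjugate_iff]
    refine ⟨?_, by simp⟩
    exact (one_lt_inv₀ h1').2 (by linarith)
  refine (ENNReal.young_inequality (a ^ (1 - t)) (b ^ t) hpq).trans (le_of_eq ?_)
  rw [← ENNReal.rpow_mul, ← ENNReal.rpow_mul, mul_inv_cancel₀ h1'.ne', mul_inv_cancel₀ h0.ne',
    ENNReal.rpow_one, ENNReal.rpow_one, ENNReal.ofReal_inv_of_pos h1', ENNReal.ofReal_inv_of_pos h0,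
    div_eq_mul_inv, div_eq_mul_inv, inv_inv, inv_inv, mul_comm a, mul_comm b]

/-- Layer-cake formula for functions truncated at level one. -/
lemma lintegral_min_one_eq {α : Type*} [MeasurableSpace α] (μ : Measure α) {v : α → ℝ≥0∞}
    (hv : Measurable v) :
    ∫⁻ x, min (v x) 1 ∂μ = ∫⁻ s in Ioo (0 : ℝ) 1, μ {x | ENNReal.ofReal s < v x} := by
  have hfin : ∀ x, min (v x) 1 ≠ ∞ := fun x => ne_top_of_le_ne_top ENNReal.one_ne_top (min_le_right _ _)
  have h1 : ∀ x, min (v x) 1 = ENNReal.ofReal (min (v x) 1).toReal := fun x =>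
    (ENNReal.ofReal_toReal (hfin x)).symm
  have hiff : ∀ s, 0 < s → ∀ x, s < (min (v x) 1).toReal ↔ ENNReal.ofReal s < v x ∧ s < 1 := by
    intro s hs x
    rw [← ENNReal.ofReal_lt_iff_lt_toReal hs.le (hfin x), lt_min_iff, ENNReal.ofReal_lt_one]
  calc ∫⁻ x, min (v x) 1 ∂μ = ∫⁻ x, ENNReal.ofReal (min (v x) 1).toReal ∂μ := by
        simp_rw [← h1]
    _ = ∫⁻ s in Ioi (0 : ℝ), μ {x | s < (min (v x) 1).toReal} :=
        lintegral_eq_lintegral_meas_lt μ (Filter.Eventually.of_forall fun _ => ENNReal.toReal_nonneg)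
          (hv.min measurable_const).ennreal_toReal.aemeasurable
    _ = ∫⁻ s in Ioi (0 : ℝ), (Ioo (0 : ℝ) 1).indicator
          (fun s => μ {x | ENNReal.ofReal s < v x}) s := by
        refine setLIntegral_congr_fun measurableSet_Ioi fun s hs => ?_
        simp only [hiff s hs]
        by_cases h : s < 1
        · rw [indicator_of_mem (show s ∈ Ioo (0 : ℝ) 1 from ⟨hs, h⟩)]
          simp [h]
        · rw [indicator_of_notMem (fun h' => h h'.2)]
          simp [h]
    _ = ∫⁻ s in Ioo (0 : ℝ) 1, μ {x | ENNReal.ofReal s < v x} := by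
        rw [lintegral_indicator measurableSet_Ioo, Measure.restrict_restrict measurableSet_Ioo,
          inter_eq_self_of_subset_left Ioo_subset_Ioi_self]

lemma prekopaLeindler_real_normalized {t : ℝ} (h0 : 0 < t) (h1 : t < 1) {f g h : ℝ → ℝ≥0∞}
    (hf : Measurable f) (hg : Measurable g) (hh : Measurable h)
    (hf1 : ∀ x, f x ≤ 1) (hg1 : ∀ x, g x ≤ 1)
    (hfs : ∀ s < 1, ∃ x, s < f x) (hgs : ∀ s < 1, ∃ x, s < g x)
    (hyp : ∀ x y, f x ^ (1 - t) * g y ^ t ≤ h ((1 - t) * x + t * y)) :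
    ENNReal.ofReal (1 - t) * (∫⁻ x, f x) + ENNReal.ofReal t * (∫⁻ x, g x) ≤ ∫⁻ x, h x := by
  have h1' : 0 < 1 - t := by linarith
  have e1 : ∫⁻ x, f x = ∫⁻ s in Ioo (0 : ℝ) 1, volume {x | ENNReal.ofReal s < f x} := by
    rw [← lintegral_min_one_eq _ hf]; simp [hf1]
  have e2 : ∫⁻ x, g x = ∫⁻ s in Ioo (0 : ℝ) 1, volume {x | ENNReal.ofReal s < g x} := by
    rw [← lintegral_min_one_eq _ hg]; simp [hg1]
  have e3 : ∫⁻ s in Ioo (0 : ℝ) 1, volume {x | ENNReal.ofReal s < h x} ≤ ∫⁻ x, h x := by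
    rw [← lintegral_min_one_eq _ hh]
    exact lintegral_mono fun x => min_le_left _ _
  refine le_trans ?_ e3
  have mono : ∀ v : ℝ → ℝ≥0∞, Antitone fun s : ℝ => volume {x | ENNReal.ofReal s < v x} :=
    fun v s s' hs => measure_mono fun x hx => (ENNReal.ofReal_le_ofReal hs).trans_lt hx
  rw [e1, e2, ← lintegral_const_mul _ (mono f).measurable,
    ← lintegral_const_mul _ (mono g).measurable,
    ← lintegral_add_left ((mono f).measurable.const_mul _)]
  refine setLIntegral_mono (mono h).measurable fun s hs => ?_
  have sc : ∀ c : ℝ, 0 < c → ∀ S : Set ℝ, ENNReal.ofReal c * volume S = volume (c • S) := by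
    intro c hc S
    rw [Measure.addHaar_smul]
    simp [abs_of_pos hc]
  rw [sc _ h1', sc _ h0]
  have hs1 : ENNReal.ofReal s < 1 := ENNReal.ofReal_lt_one.2 hs.2
  refine volume_add_volume_le ((measurableSet_lt measurable_const hf).const_smul₀ _)
    ((measurableSet_lt measurable_const hg).const_smul₀ _) ?_ ?_ ?_
  · exact Set.Nonempty.smul_set (hfs _ hs1)
  · exact Set.Nonempty.smul_set (hgs _ hs1)
  · rintro _ ⟨x, hx, rfl⟩ _ ⟨y, hy, rfl⟩
    refine lt_of_lt_of_le ?_ (hyp x y)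
    have hs0 : 0 < ENNReal.ofReal s := ENNReal.ofReal_pos.2 hs.1
    calc ENNReal.ofReal s = ENNReal.ofReal s ^ (1 - t) * ENNReal.ofReal s ^ t := by
          rw [← ENNReal.rpow_add _ _ hs0.ne' ENNReal.ofReal_ne_top]; simp
      _ < f x ^ (1 - t) * g y ^ t :=
          ENNReal.mul_lt_mul (ENNReal.rpow_lt_rpow hx h1') (ENNReal.rpow_lt_rpow hy h0)

/-- The conclusion of the Prékopa–Leindler inequality with parameter `t` on a measure space `E`. -/
def PrekopaLeindler (E : Type*) [AddCommGroup E] [Module ℝ E] [MeasureSpace E] (t : ℝ) : Prop :=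
  ∀ f g h : E → ℝ≥0∞, Measurable f → Measurable g → Measurable h →
    (∀ x y, f x ^ (1 - t) * g y ^ t ≤ h ((1 - t) • x + t • y)) →
    (∫⁻ x, f x) ^ (1 - t) * (∫⁻ x, g x) ^ t ≤ ∫⁻ x, h x

lemma prekopaLeindler_real_of_le {t : ℝ} (h0 : 0 < t) (h1 : t < 1) {f g h : ℝ → ℝ≥0∞}
    (hf : Measurable f) (hg : Measurable g) (hh : Measurable h) {N : ℝ≥0∞} (hN : N ≠ ∞)
    (hfN : ∀ x, f x ≤ N) (hgN : ∀ x, g x ≤ N)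
    (hyp : ∀ x y, f x ^ (1 - t) * g y ^ t ≤ h ((1 - t) * x + t * y)) :
    (∫⁻ x, f x) ^ (1 - t) * (∫⁻ x, g x) ^ t ≤ ∫⁻ x, h x := by
  have h1' : 0 < 1 - t := by linarith
  set F := ⨆ x, f x
  set G := ⨆ x, g x
  have hFt : F ≠ ∞ := ne_top_of_le_ne_top hN (iSup_le hfN)
  have hGt : G ≠ ∞ := ne_top_of_le_ne_top hN (iSup_le hgN)
  rcases eq_or_ne F 0 with hF0 | hF0
  · have : ∀ x, f x = 0 := fun x => le_antisymm (hF0 ▸ le_iSup f x) zero_le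
    simp [this, ENNReal.zero_rpow_of_pos h1']
  rcases eq_or_ne G 0 with hG0 | hG0
  · have : ∀ x, g x = 0 := fun x => le_antisymm (hG0 ▸ le_iSup g x) zero_le
    simp [this, ENNReal.zero_rpow_of_pos h0]
  set c := F⁻¹ ^ (1 - t) * G⁻¹ ^ t
  have sup1 : ∀ (v : ℝ → ℝ≥0∞), (⨆ x, v x) ≠ ∞ → (⨆ x, v x) ≠ 0 → ∀ s < 1,
      ∃ x, s < (⨆ x, v x)⁻¹ * v x := by
    intro v hv hv0 s hs
    have : s * (⨆ x, v x) < ⨆ x, v x := by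
      calc s * (⨆ x, v x) < 1 * (⨆ x, v x) := by
            exact (ENNReal.mul_lt_mul_iff_left hv0 hv).2 hs
        _ = _ := one_mul _
    obtain ⟨x, hx⟩ := lt_iSup_iff.1 this
    refine ⟨x, ?_⟩
    rw [mul_comm, ← div_eq_mul_inv]
    exact (ENNReal.lt_div_iff_mul_lt (Or.inl hv0) (Or.inl hv)).2 hx
  have le1 : ∀ (v : ℝ → ℝ≥0∞), ∀ x, (⨆ x, v x)⁻¹ * v x ≤ 1 := fun v x =>
    (mul_le_mul_right (le_iSup v x) _).trans (ENNReal.inv_mul_le_one _)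
  have key := prekopaLeindler_real_normalized h0 h1 (hf.const_mul F⁻¹) (hg.const_mul G⁻¹)
    (hh.const_mul c) (le1 f) (le1 g) (sup1 f hFt hF0) (sup1 g hGt hG0) (fun x y => by
      rw [ENNReal.mul_rpow_of_nonneg _ _ h1'.le, ENNReal.mul_rpow_of_nonneg _ _ h0.le,
        mul_mul_mul_comm]
      exact mul_le_mul_right (hyp x y) _)
  have key2 := (ENNReal.rpow_mul_rpow_le_add _ _ h0 h1).trans key
  rw [lintegral_const_mul _ hf, lintegral_const_mul _ hg, lintegral_const_mul _ hh,
    ENNReal.mul_rpow_of_nonneg _ _ h1'.le, ENNReal.mul_rpow_of_nonneg _ _ h0.le,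
        mul_mul_mul_comm] at key2
  refine (ENNReal.mul_le_mul_iff_right ?_ ?_).1 key2
  · simp [hFt, hGt, ENNReal.rpow_eq_zero_iff, hF0, hG0]
  · exact ENNReal.mul_ne_top (ENNReal.rpow_ne_top_of_nonneg h1'.le (ENNReal.inv_ne_top.2 hF0))
      (ENNReal.rpow_ne_top_of_nonneg h0.le (ENNReal.inv_ne_top.2 hG0))

/-- The Prékopa–Leindler inequality on the real line. -/
lemma prekopaLeindler_real {t : ℝ} (h0 : 0 < t) (h1 : t < 1) : PrekopaLeindler ℝ t := by
  intro f g h hf hg hh hyp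
  have h1' : 0 < 1 - t := by linarith
  rcases eq_or_ne (∫⁻ x, f x) 0 with hf0 | hf0
  · simp [hf0, ENNReal.zero_rpow_of_pos h1']
  rcases eq_or_ne (∫⁻ x, g x) 0 with hg0 | hg0
  · simp [hg0, ENNReal.zero_rpow_of_pos h0]
  have trunc : ∀ v : ℝ → ℝ≥0∞, Measurable v → Filter.Tendsto (fun n : ℕ => ∫⁻ x, min (v x) n)
      Filter.atTop (nhds (∫⁻ x, v x)) := by
    intro v hv
    refine lintegral_tendsto_of_tendsto_of_monotone
      (fun n => (hv.min measurable_const).aemeasurable) ?_ ?_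
    · exact Filter.Eventually.of_forall fun x n m hnm =>
        min_le_min_left _ (by exact_mod_cast hnm)
    · refine Filter.Eventually.of_forall fun x => ?_
      have := (tendsto_const_nhds (x := v x)).min ENNReal.tendsto_nat_nhds_top
      simpa using this
  have lim := ENNReal.Tendsto.mul
    ((ENNReal.continuous_rpow_const (y := 1 - t)).continuousAt.tendsto.comp (trunc f hf))
    (Or.inl (by simp [ENNReal.rpow_eq_zero_iff, hf0, h1'.not_gt]))
    ((ENNReal.continuous_rpow_const (y := t)).continuousAt.tendsto.comp (trunc g hg))
    (Or.inl (by simp [ENNReal.rpow_eq_zero_iff, hg0, h0.not_gt]))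
  refine le_of_tendsto' lim fun n => ?_
  refine prekopaLeindler_real_of_le h0 h1 (hf.min measurable_const) (hg.min measurable_const) hh
    (N := n) (by simp) (fun x => min_le_right _ _) (fun x => min_le_right _ _) fun x y => ?_
  refine le_trans ?_ (hyp x y)
  gcongr <;> exact min_le_left _ _

/-- The Prékopa–Leindler inequality tensorizes. -/
lemma PrekopaLeindler.prod {E F : Type*} [AddCommGroup E] [Module ℝ E] [MeasureSpace E]
    [AddCommGroup F] [Module ℝ F] [MeasureSpace F] [SFinite (volume : Measure E)]
    [SFinite (volume : Measure F)] {t : ℝ} (hE : PrekopaLeindler E t)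
    (hF : PrekopaLeindler F t) : PrekopaLeindler (E × F) t := by
  intro f g h hf hg hh hyp
  rw [Measure.volume_eq_prod, lintegral_prod _ hf.aemeasurable, lintegral_prod _ hg.aemeasurable,
    lintegral_prod _ hh.aemeasurable]
  refine hE _ _ _ hf.lintegral_prod_right' hg.lintegral_prod_right' hh.lintegral_prod_right'
    fun x y => ?_
  exact hF _ _ _ (hf.comp measurable_prodMk_left) (hg.comp measurable_prodMk_left)
    (hh.comp measurable_prodMk_left) fun u v => hyp (x, u) (y, v)

/-- The Prékopa–Leindler inequality is invariant under linear volume-preserving equivalences. -/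
lemma PrekopaLeindler.of_equiv {E F : Type*} [AddCommGroup E] [Module ℝ E] [MeasureSpace E]
    [AddCommGroup F] [Module ℝ F] [MeasureSpace F] {t : ℝ} (hE : PrekopaLeindler E t)
    (e : E ≃ᵐ F) (he : MeasurePreserving e)
    (hlin : ∀ x y, e ((1 - t) • x + t • y) = (1 - t) • e x + t • e y) :
    PrekopaLeindler F t := by
  intro f g h hf hg hh hyp
  rw [← he.lintegral_comp hf, ← he.lintegral_comp hg, ← he.lintegral_comp hh]
  refine hE _ _ _ (hf.comp e.measurable) (hg.comp e.measurable) (hh.comp e.measurable)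
    fun x y => ?_
  simp only [hlin]
  exact hyp _ _

lemma prekopaLeindler_pi {t : ℝ} (h0 : 0 < t) (h1 : t < 1) (n : ℕ) :
    PrekopaLeindler (Fin n → ℝ) t := by
  induction n with
  | zero =>
    intro f g h hf hg hh hyp
    simp only [volume_pi, Measure.pi_of_empty (fun _ : Fin 0 => (volume : Measure ℝ)) default,
      lintegral_dirac' _ hf, lintegral_dirac' _ hg, lintegral_dirac' _ hh]
    exact (hyp default default).trans (le_of_eq (congrArg h (Subsingleton.elim _ _)))
  | succ n ih =>
    refine ((prekopaLeindler_real h0 h1).prod ih).of_equiv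
      (MeasurableEquiv.piFinSuccAbove (fun _ => ℝ) 0).symm
      (volume_preserving_piFinSuccAbove (fun _ => ℝ) 0).symm fun x y => ?_
    apply (MeasurableEquiv.piFinSuccAbove (fun _ : Fin (n + 1) => ℝ) 0).injective
    rw [MeasurableEquiv.apply_symm_apply]
    ext i
    · simp
    · simp [MeasurableEquiv.piFinSuccAbove, Fin.insertNthEquiv, Fin.tail]

/-- The Prékopa–Leindler inequality on Euclidean space. -/
lemma prekopaLeindler_euclidean {t : ℝ} (h0 : 0 < t) (h1 : t < 1) (n : ℕ) :
    PrekopaLeindler (En n) t :=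
  (prekopaLeindler_pi h0 h1 n).of_equiv (MeasurableEquiv.toLp 2 (Fin n → ℝ))
    (EuclideanSpace.volume_preserving_symm_measurableEquiv_toLp _).symm fun _ _ => rfl

/-- A log-concave measure has a Borel measurable log-concave density. -/
lemma IsLogConcave.exists_density {n : ℕ} {μ : Measure (En n)} (hlc : IsLogConcave μ) :
    ∃ p : En n → ℝ≥0∞, Measurable p ∧ μ = volume.withDensity p ∧
      ∀ t : ℝ, 0 < t → t < 1 → ∀ x y, p x ^ (1 - t) * p y ^ t ≤ p ((1 - t) • x + t • y) := by
  classical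
  obtain ⟨s, W, hs, hW, rfl⟩ := hlc
  refine ⟨(interior s).indicator fun x => ENNReal.ofReal (Real.exp (-W x)), ?_, ?_, ?_⟩
  · rw [← Set.piecewise_eq_indicator]
    refine ContinuousOn.measurable_piecewise ?_ continuousOn_const isOpen_interior.measurableSet
    exact ENNReal.continuous_ofReal.comp_continuousOn
      (Real.continuous_exp.comp_continuousOn hW.continuousOn_interior.neg)
  · refine withDensity_congr_ae ?_
    have hfr : ∀ᵐ x ∂(volume : Measure (En n)), x ∉ frontier s :=
      measure_eq_zero_iff_ae_notMem.1 (hs.addHaar_frontier volume)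
    filter_upwards [hfr] with x hx
    by_cases hxs : x ∈ s
    · have : x ∈ interior s := by
        by_contra h
        exact hx ⟨subset_closure hxs, h⟩
      rw [indicator_of_mem hxs, indicator_of_mem this]
    · rw [indicator_of_notMem hxs, indicator_of_notMem fun h => hxs (interior_subset h)]
  · intro t h0 h1 x y
    have h1' : 0 < 1 - t := by linarith
    by_cases hx : x ∈ interior s
    swap
    · simp [indicator_of_notMem hx, ENNReal.zero_rpow_of_pos h1']
    by_cases hy : y ∈ interior s
    swap
    · simp [indicator_of_notMem hy, ENNReal.zero_rpow_of_pos h0]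
    have hz := hs.interior hx hy h1'.le h0.le (by ring)
    rw [indicator_of_mem hx, indicator_of_mem hy, indicator_of_mem hz,
      ENNReal.ofReal_rpow_of_pos (Real.exp_pos _), ENNReal.ofReal_rpow_of_pos (Real.exp_pos _),
      ← ENNReal.ofReal_mul (by positivity), ← Real.exp_mul, ← Real.exp_mul, ← Real.exp_add]
    refine ENNReal.ofReal_le_ofReal (Real.exp_le_exp.2 ?_)
    have := hW.2 (interior_subset hx) (interior_subset hy) h1'.le h0.le (by ring)
    simp only [smul_eq_mul] at this
    linarith

/-- Log-concavity of a log-concave measure as a set function. -/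
lemma IsLogConcave.measure_rpow_mul_le {n : ℕ} {μ : Measure (En n)} (hlc : IsLogConcave μ)
    {t : ℝ} (h0 : 0 < t) (h1 : t < 1) {A B C : Set (En n)} (hA : MeasurableSet A)
    (hB : MeasurableSet B) (hC : MeasurableSet C)
    (h : ∀ a ∈ A, ∀ b ∈ B, (1 - t) • a + t • b ∈ C) :
    μ A ^ (1 - t) * μ B ^ t ≤ μ C := by
  obtain ⟨p, hp, rfl, hpc⟩ := hlc.exists_density
  have h1' : 0 < 1 - t := by linarith
  rw [withDensity_apply _ hA, withDensity_apply _ hB, withDensity_apply _ hC,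
    ← lintegral_indicator hA, ← lintegral_indicator hB, ← lintegral_indicator hC]
  refine prekopaLeindler_euclidean h0 h1 n _ _ _ (hp.indicator hA) (hp.indicator hB)
    (hp.indicator hC) fun x y => ?_
  by_cases hx : x ∈ A
  swap
  · simp [indicator_of_notMem hx, ENNReal.zero_rpow_of_pos h1']
  by_cases hy : y ∈ B
  swap
  · simp [indicator_of_notMem hy, ENNReal.zero_rpow_of_pos h0]
  rw [indicator_of_mem hx, indicator_of_mem hy, indicator_of_mem (h x hx y hy)]
  exact hpc t h0 h1 x y

/-- Borell's lemma: geometric decay of the mass outside dilated balls. -/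
lemma IsLogConcave.measure_lt_dist_le {n : ℕ} {μ : Measure (En n)} [IsProbabilityMeasure μ]
    (hlc : IsLogConcave μ) {x₀ : En n} {r : ℝ} (hr : μ.real {x | r < dist x x₀} ≤ 1 / 4) (j : ℕ) :
    μ.real {x | (2 * j + 3) * r < dist x x₀} ≤ 1 / 4 * (1 / 3) ^ (j + 1) := by
  set a := μ.real {x | (2 * j + 3) * r < dist x x₀} with ha
  set δ := μ.real {x | r < dist x x₀} with hδ
  have hCm : MeasurableSet {x : En n | r < dist x x₀} :=
    measurableSet_lt measurable_const (measurable_id.dist measurable_const)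
  have hθ : μ.real {x | r < dist x x₀}ᶜ = 1 - δ := probReal_compl_eq_one_sub hCm
  set t : ℝ := (j + 1) / (j + 2) with ht
  have hj : (0 : ℝ) ≤ j := j.cast_nonneg
  have h0 : 0 < t := by positivity
  have h1 : t < 1 := by rw [ht, div_lt_one (by positivity)]; linarith
  have h1t : 1 - t = 1 / (j + 2) := by rw [ht]; field_simp; ring
  have key := hlc.measure_rpow_mul_le h0 h1 (A := {x | (2 * j + 3) * r < dist x x₀})
    (measurableSet_lt measurable_const (measurable_id.dist measurable_const)) hCm.compl hCm (by
      intro x hx y hy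
      simp only [mem_ofPred_eq, mem_compl_iff, not_lt, dist_eq_norm] at *
      have e : x - x₀ = (j + 2 : ℝ) • ((1 - t) • x + t • y - x₀) - (j + 1 : ℝ) • (y - x₀) := by
        have e1 : (j + 2 : ℝ) • ((1 - t) • x + t • y - x₀)
            = ((j + 2) * (1 - t)) • x + ((j + 2) * t) • y - (j + 2 : ℝ) • x₀ := by module
        rw [e1, show (j + 2 : ℝ) * (1 - t) = 1 by rw [h1t]; field_simp,
          show (j + 2 : ℝ) * t = j + 1 by rw [ht]; field_simp]
        module
      have h2 := norm_sub_le ((j + 2 : ℝ) • ((1 - t) • x + t • y - x₀)) ((j + 1 : ℝ) • (y - x₀))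
      rw [← e, norm_smul, norm_smul, Real.norm_of_nonneg (by positivity),
        Real.norm_of_nonneg (by positivity)] at h2
      by_contra! h3
      nlinarith)
  have key' : a ^ (1 - t) * (1 - δ) ^ t ≤ δ := by
    have := ENNReal.toReal_mono (measure_ne_top μ _) key
    rw [ENNReal.toReal_mul, ← ENNReal.toReal_rpow, ← ENNReal.toReal_rpow] at this
    rw [← hθ]
    exact this
  have ha0 : 0 ≤ a := measureReal_nonneg
  have hθ0 : 0 ≤ 1 - δ := by linarith
  have key2 : a * (1 - δ) ^ (j + 1) ≤ δ ^ (j + 2) := by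
    have := pow_le_pow_left₀ (by positivity) key' (j + 2)
    rwa [mul_pow, ← Real.rpow_mul_natCast ha0, ← Real.rpow_mul_natCast hθ0,
      show (1 - t) * ((j + 2 : ℕ) : ℝ) = 1 by rw [h1t]; push_cast; field_simp,
      show t * ((j + 2 : ℕ) : ℝ) = ((j + 1 : ℕ) : ℝ) by rw [ht]; push_cast; field_simp,
      Real.rpow_one, Real.rpow_natCast] at this
  have hδ0 : 0 ≤ δ := measureReal_nonneg
  have k3 : a * (3 / 4) ^ (j + 1) ≤ (1 / 4) ^ (j + 2) :=
    calc a * (3 / 4) ^ (j + 1) ≤ a * (1 - δ) ^ (j + 1) := by gcongr; linarith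
      _ ≤ δ ^ (j + 2) := key2
      _ ≤ _ := by gcongr
  have e : (1 / 4 : ℝ) ^ (j + 2) = (1 / 4 * (1 / 3) ^ (j + 1)) * (3 / 4) ^ (j + 1) := by
    rw [mul_assoc, ← mul_pow, pow_succ' _ (j + 1)]; norm_num
  rw [e] at k3
  exact le_of_mul_le_mul_right k3 (by positivity)

/-- Log-concave probability measures have finite second moments. -/
lemma IsLogConcave.integrable_norm_sub_sq {n : ℕ} {μ : Measure (En n)} [IsProbabilityMeasure μ]
    (hlc : IsLogConcave μ) (x₀ : En n) : Integrable (fun x => ‖x - x₀‖ ^ 2) μ := by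
  obtain ⟨r, hr0, hr⟩ : ∃ r : ℝ, 0 < r ∧ μ.real {x | r < dist x x₀} ≤ 1 / 4 := by
    have hlim : Filter.Tendsto (fun k : ℕ => μ {x | (k : ℝ) < dist x x₀}) Filter.atTop
        (nhds (μ (⋂ k : ℕ, {x | (k : ℝ) < dist x x₀}))) :=
      tendsto_measure_iInter_atTop
        (fun k => (measurableSet_lt measurable_const
          (measurable_id.dist measurable_const)).nullMeasurableSet)
        (fun k l hkl x hx => lt_of_le_of_lt (by exact_mod_cast hkl) (show (l : ℝ) < _ from hx))
        ⟨0, measure_ne_top _ _⟩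
    have hempty : (⋂ k : ℕ, {x : En n | (k : ℝ) < dist x x₀}) = ∅ := by
      refine eq_empty_of_forall_notMem fun x hx => ?_
      obtain ⟨k, hk⟩ := exists_nat_gt (dist x x₀)
      exact lt_asymm hk (mem_iInter.1 hx k)
    rw [hempty, measure_empty] at hlim
    obtain ⟨k, hk, hk0⟩ := ((hlim.eventually_le_const (u := ENNReal.ofReal (1 / 4))
      (by simp)).and (Filter.eventually_gt_atTop 0)).exists
    exact ⟨k, by exact_mod_cast hk0, ENNReal.toReal_le_of_le_ofReal (by norm_num) hk⟩
  have hmeas : Measurable fun x : En n => ‖x - x₀‖ ^ 2 := by fun_prop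
  set A : ℕ → Set (En n) := fun j => {x | (2 * j + 3) * r < dist x x₀}
  have hAm : ∀ j, MeasurableSet (A j) := fun j =>
    measurableSet_lt measurable_const (measurable_id.dist measurable_const)
  set c : ℕ → ℝ := fun j => ((2 * j + 5) * r) ^ 2 with hc
  refine ⟨hmeas.aestronglyMeasurable, ?_⟩
  rw [hasFiniteIntegral_iff_ofReal (Filter.Eventually.of_forall fun x => by positivity)]
  have hpt : ∀ x, ENNReal.ofReal (‖x - x₀‖ ^ 2) ≤ ENNReal.ofReal ((5 * r) ^ 2) +
      ∑' j, (A j).indicator (fun _ => ENNReal.ofReal (c j)) x := by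
    intro x
    rcases le_or_gt (dist x x₀) (5 * r) with h | h
    · refine le_trans (ENNReal.ofReal_le_ofReal ?_) le_self_add
      rw [dist_eq_norm] at h
      gcongr
    · refine le_trans ?_ le_add_self
      set y := (dist x x₀ - 5 * r) / (2 * r) with hy
      have hy0 : 0 ≤ y := div_nonneg (by linarith) (by linarith)
      have hyr : y * (2 * r) = dist x x₀ - 5 * r := by rw [hy]; field_simp
      have hl := Nat.le_ceil y
      have hu := Nat.ceil_lt_add_one hy0
      refine le_trans ?_ (ENNReal.le_tsum ⌈y⌉₊)
      have hx : x ∈ A ⌈y⌉₊ := show (2 * ⌈y⌉₊ + 3) * r < dist x x₀ by nlinarith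
      rw [indicator_of_mem hx]
      refine ENNReal.ofReal_le_ofReal ?_
      rw [← dist_eq_norm, hc]
      have : dist x x₀ ≤ (2 * ⌈y⌉₊ + 5) * r := by nlinarith
      exact pow_le_pow_left₀ dist_nonneg this 2
  refine (lintegral_mono hpt).trans_lt ?_
  rw [lintegral_add_left measurable_const, lintegral_const, measure_univ, mul_one,
    lintegral_tsum fun j => (measurable_const.indicator (hAm j)).aemeasurable]
  refine ENNReal.add_lt_top.2 ⟨ENNReal.ofReal_lt_top, ?_⟩
  have hsum : Summable fun j : ℕ => c j * (1 / 4 * (1 / 3) ^ (j + 1)) := by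
    have h2 := summable_pow_mul_geometric_of_norm_lt_one (R := ℝ) 2 (r := 1 / 3) (by norm_num)
    have h1 := summable_pow_mul_geometric_of_norm_lt_one (R := ℝ) 1 (r := 1 / 3) (by norm_num)
    have h0 := summable_pow_mul_geometric_of_norm_lt_one (R := ℝ) 0 (r := 1 / 3) (by norm_num)
    refine (((h2.mul_left (4 * r ^ 2 / 12)).add (h1.mul_left (20 * r ^ 2 / 12))).add
      (h0.mul_left (25 * r ^ 2 / 12))).congr fun j => ?_
    simp only [hc, pow_succ]
    ring
  refine lt_of_le_of_lt (ENNReal.tsum_le_tsum fun j => ?_) hsum.tsum_ofReal_lt_top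
  rw [lintegral_indicator_const (hAm j), ENNReal.ofReal_mul (by positivity)]
  gcongr
  rw [← ENNReal.ofReal_toReal (measure_ne_top μ (A j))]
  exact ENNReal.ofReal_le_ofReal (hlc.measure_lt_dist_le hr j)

lemma mul_add_one_le_rpow_mul_rpow {a β t : ℝ} (ha : 0 ≤ a) (hβ : 0 < β) (ht : t < 1) :
    a + t * (a * Real.log β - a * Real.log a) ≤ a ^ (1 - t) * β ^ t := by
  rcases ha.eq_or_lt with rfl | ha
  · simp [Real.zero_rpow (by linarith : 1 - t ≠ 0)]
  have e : a ^ (1 - t) * β ^ t = a * Real.exp (t * (Real.log β - Real.log a)) := by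
    rw [Real.rpow_def_of_pos ha, Real.rpow_def_of_pos hβ, ← Real.exp_add]
    conv_rhs => rw [← Real.exp_log ha, ← Real.exp_add, Real.exp_log ha]
    ring_nf
  rw [e]
  nlinarith [Real.add_one_le_exp (t * (Real.log β - Real.log a))]

/-- The levels strictly between the infimum and the supremum of `u` on the ball obtained from
the ball of radius `r` centered at `z - x₀` by scaling by `τ` and translating by `z`. -/
def levelGap {n : ℕ} (u : En n → ℝ) (x₀ : En n) (r τ : ℝ) (z : En n) : Set ℝ :=
  {s | (∃ e, ‖e‖ ≤ r ∧ s < u (z + τ • (z - x₀ + e))) ∧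
    ∃ e, ‖e‖ ≤ r ∧ u (z + τ • (z - x₀ + e)) < s}

lemma isOpen_levelGap {n : ℕ} {u : En n → ℝ} (hu : Continuous u) (x₀ : En n) (r τ : ℝ) :
    IsOpen {p : En n × ℝ | p.2 ∈ levelGap u x₀ r τ p.1} := by
  have h1 : IsOpen (⋃ e : En n, ⋃ (_ : ‖e‖ ≤ r),
      {p : En n × ℝ | p.2 < u (p.1 + τ • (p.1 - x₀ + e))}) :=
    isOpen_iUnion fun e => isOpen_iUnion fun _ => isOpen_lt (by fun_prop) (by fun_prop)
  have h2 : IsOpen (⋃ e : En n, ⋃ (_ : ‖e‖ ≤ r),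
      {p : En n × ℝ | u (p.1 + τ • (p.1 - x₀ + e)) < p.2}) :=
    isOpen_iUnion fun e => isOpen_iUnion fun _ => isOpen_lt (by fun_prop) (by fun_prop)
  convert h1.inter h2 using 1
  ext p
  simp [levelGap]

lemma levelGap_subset_Icc {n : ℕ} {u : En n → ℝ} {x₀ : En n} {r τ : ℝ} {z : En n} {c M : ℝ}
    (h : ∀ e, ‖e‖ ≤ r → |u (z + τ • (z - x₀ + e)) - c| ≤ M) :
    levelGap u x₀ r τ z ⊆ Icc (c - M) (c + M) := by
  rintro s ⟨⟨e, he, hs⟩, ⟨e', he', hs'⟩⟩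
  have h1 := abs_le.1 (h e he)
  have h2 := abs_le.1 (h e' he')
  constructor <;> linarith

/-- The measure of the set of points whose level gap contains a given level. -/
lemma IsLogConcave.ofReal_le_measure_levelGap {n : ℕ} {μ : Measure (En n)}
    [IsProbabilityMeasure μ] (hlc : IsLogConcave μ) {x₀ : En n} {r : ℝ}
    (hβ : 0 < μ.real (Metric.closedBall x₀ r)) {u : En n → ℝ} (hu : Continuous u) {s : ℝ}
    (hs : μ {x | u x = s} = 0) {τ : ℝ} (hτ : 0 < τ) :
    τ / (1 + τ) * (Real.log (μ.real (Metric.closedBall x₀ r))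
      - μ.real {x | s < u x} * Real.log (μ.real {x | s < u x})
      - (1 - μ.real {x | s < u x}) * Real.log (1 - μ.real {x | s < u x}))
      ≤ μ.real {z | s ∈ levelGap u x₀ r τ z} := by
  set t := τ / (1 + τ) with ht
  have h0 : 0 < t := by positivity
  have h1 : t < 1 := by rw [ht, div_lt_one (by positivity)]; linarith
  have e1 : (1 + τ) * (1 - t) = 1 := by rw [ht]; field_simp; ring
  have e2 : (1 + τ) * t = τ := by rw [ht]; field_simp
  set β := μ.real (Metric.closedBall x₀ r) with hβdef
  set P : Set (En n) := {z | ∃ e, ‖e‖ ≤ r ∧ s < u (z + τ • (z - x₀ + e))} with hP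
  set N : Set (En n) := {z | ∃ e, ‖e‖ ≤ r ∧ u (z + τ • (z - x₀ + e)) < s} with hN
  have hPo : IsOpen P := by
    have h1 : IsOpen (⋃ e : En n, ⋃ (_ : ‖e‖ ≤ r), {z : En n | s < u (z + τ • (z - x₀ + e))}) :=
      isOpen_iUnion fun e => isOpen_iUnion fun _ => isOpen_lt (by fun_prop) (by fun_prop)
    convert h1 using 1
    ext p
    simp [hP]
  have hNo : IsOpen N := by
    have h1 : IsOpen (⋃ e : En n, ⋃ (_ : ‖e‖ ≤ r), {z : En n | u (z + τ • (z - x₀ + e)) < s}) :=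
      isOpen_iUnion fun e => isOpen_iUnion fun _ => isOpen_lt (by fun_prop) (by fun_prop)
    convert h1 using 1
    ext p
    simp [hN]
  have hcomb : ∀ a b : En n, b ∈ Metric.closedBall x₀ r →
      ∃ e : En n, ‖e‖ ≤ r ∧ ((1 - t) • a + t • b) + τ • (((1 - t) • a + t • b) - x₀ + e) = a := by
    intro a b hb
    refine ⟨-(b - x₀), by rw [norm_neg, ← dist_eq_norm]; exact hb, ?_⟩
    have : ((1 - t) • a + t • b) + τ • (((1 - t) • a + t • b) - x₀ + -(b - x₀))
        = ((1 + τ) * (1 - t)) • a + ((1 + τ) * t) • b - τ • b := by module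
    rw [this, e1, e2]
    module
  have toR : ∀ A C : Set (En n), μ A ^ (1 - t) * μ (Metric.closedBall x₀ r) ^ t ≤ μ C →
      μ.real A ^ (1 - t) * β ^ t ≤ μ.real C := by
    intro A C h
    have := ENNReal.toReal_mono (measure_ne_top μ _) h
    rwa [ENNReal.toReal_mul, ← ENNReal.toReal_rpow, ← ENNReal.toReal_rpow] at this
  have hA := toR _ _ <| hlc.measure_rpow_mul_le h0 h1 (A := {x | s < u x})
    (B := Metric.closedBall x₀ r) (C := P)
    (isOpen_lt continuous_const hu).measurableSet Metric.isClosed_closedBall.measurableSet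
    hPo.measurableSet (by
      intro a ha b hb
      obtain ⟨e, he, hab⟩ := hcomb a b hb
      exact ⟨e, he, by rw [hab]; exact ha⟩)
  have hB := toR _ _ <| hlc.measure_rpow_mul_le h0 h1 (A := {x | u x < s})
    (B := Metric.closedBall x₀ r) (C := N)
    (isOpen_lt hu continuous_const).measurableSet Metric.isClosed_closedBall.measurableSet
    hNo.measurableSet (by
      intro a ha b hb
      obtain ⟨e, he, hab⟩ := hcomb a b hb
      exact ⟨e, he, by rw [hab]; exact ha⟩)
  set a := μ.real {x | s < u x} with ha
  have hb : μ.real {x | u x < s} = 1 - a := by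
    rw [ha, ← probReal_compl_eq_one_sub (isOpen_lt continuous_const hu).measurableSet]
    refine measureReal_congr ?_
    filter_upwards [measure_eq_zero_iff_ae_notMem.1 hs] with x hx
    refine propext ?_
    change u x < s ↔ ¬ s < u x
    rw [not_lt]
    exact ⟨le_of_lt, fun h => lt_of_le_of_ne h hx⟩
  rw [hb] at hB
  have ha0 : 0 ≤ a := measureReal_nonneg
  have ha1 : a ≤ 1 := measureReal_le_one
  have hPN := measureReal_union_add_inter (μ := μ) (s := P) hNo.measurableSet
  have hPN1 : μ.real (P ∪ N) ≤ 1 := measureReal_le_one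
  have l1 := mul_add_one_le_rpow_mul_rpow ha0 hβ h1
  have l2 := mul_add_one_le_rpow_mul_rpow (sub_nonneg.2 ha1) hβ h1
  change _ ≤ μ.real (P ∩ N)
  nlinarith

/-- Asymptotics of the size of the level gaps at a point of differentiability. -/
lemma limsup_volume_levelGap_le {n : ℕ} {u : En n → ℝ} {x₀ : En n} {r : ℝ} (hr : 0 ≤ r)
    {z : En n} (hu : DifferentiableAt ℝ u z) {K : Set ℝ} (hK : IsClosed K) :
    Filter.limsup (fun k : ℕ => ENNReal.ofReal (k + 2) *
        volume.restrict K (levelGap u x₀ r (1 / (k + 1)) z)) Filter.atTop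
      ≤ (u ⁻¹' K).indicator (fun z => ENNReal.ofReal (2 * r) * ‖fderiv ℝ u z‖ₑ) z := by
  set D := fderiv ℝ u z with hD
  set M := ‖z - x₀‖ + r with hM
  have hM0 : 0 ≤ M := by positivity
  have hτ : Filter.Tendsto (fun k : ℕ => 1 / ((k : ℝ) + 1)) Filter.atTop (nhds 0) :=
    tendsto_one_div_add_atTop_nhds_zero_nat
  have key : ∀ ε > 0, ∀ᶠ k : ℕ in Filter.atTop, levelGap u x₀ r (1 / (k + 1)) z ⊆
      Icc (u z + 1 / (k + 1) * D (z - x₀) - 1 / (k + 1) * (r * ‖D‖ + ε * M))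
        (u z + 1 / (k + 1) * D (z - x₀) + 1 / (k + 1) * (r * ‖D‖ + ε * M)) := by
    intro ε hε
    have h1 := hu.hasFDerivAt.isLittleO.def hε
    obtain ⟨η, hη, h2⟩ := Metric.eventually_nhds_iff.1 h1
    have h3 : ∀ᶠ k : ℕ in Filter.atTop, 1 / ((k : ℝ) + 1) * M < η := by
      have := hτ.mul_const M
      rw [zero_mul] at this
      exact this.eventually_lt_const hη
    filter_upwards [h3] with k hk
    set τ : ℝ := 1 / (k + 1) with hτdef
    have hτ0 : 0 ≤ τ := by positivity
    refine levelGap_subset_Icc fun e he => ?_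
    have hv : ‖z - x₀ + e‖ ≤ M := norm_add_le_of_le le_rfl he
    have hd : ‖τ • (z - x₀ + e)‖ ≤ τ * M := by
      rw [norm_smul, Real.norm_of_nonneg hτ0]; gcongr
    have h4 := h2 (y := z + τ • (z - x₀ + e)) (by
      rw [dist_eq_norm, add_sub_cancel_left]; exact hd.trans_lt hk)
    rw [add_sub_cancel_left, ← hD, map_smul, map_add, Real.norm_eq_abs, smul_eq_mul] at h4
    have h5 : |D e| ≤ r * ‖D‖ := by
      rw [← Real.norm_eq_abs, mul_comm]
      exact (D.le_opNorm e).trans (by gcongr)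
    have h6 : ε * ‖τ • (z - x₀ + e)‖ ≤ ε * (τ * M) := by gcongr
    have h7 := abs_le.1 (h4.trans h6)
    have h8 := abs_le.1 h5
    rw [abs_le]
    constructor <;> nlinarith
  by_cases hz : u z ∈ K
  swap
  · rw [indicator_of_notMem (show z ∉ u ⁻¹' K from hz)]
    obtain ⟨η, hη, hball⟩ := Metric.isOpen_iff.1 hK.isOpen_compl (u z) hz
    have h3 : ∀ᶠ k : ℕ in Filter.atTop,
        1 / ((k : ℝ) + 1) * (|D (z - x₀)| + (r * ‖D‖ + 1 * M)) < η := by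
      have := hτ.mul_const (|D (z - x₀)| + (r * ‖D‖ + 1 * M))
      rw [zero_mul] at this
      exact this.eventually_lt_const hη
    refine (Filter.limsup_le_of_le (by isBoundedDefault) ?_)
    filter_upwards [key 1 one_pos, h3] with k hk h3
    rw [Measure.restrict_apply' hK.measurableSet, eq_empty_of_forall_notMem (s := _ ∩ K),
      measure_empty, mul_zero]
    rintro s ⟨hs, hsK⟩
    refine hball ?_ hsK
    have := hk hs
    have hτ0 : (0 : ℝ) ≤ 1 / (k + 1) := by positivity
    have h4 := mul_le_mul_of_nonneg_left (le_abs_self (D (z - x₀))) hτ0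
    have h5 := mul_le_mul_of_nonneg_left (neg_abs_le (D (z - x₀))) hτ0
    rw [Metric.mem_ball, Real.dist_eq, abs_lt]
    constructor <;> nlinarith [this.1, this.2]
  · rw [indicator_of_mem (show z ∈ u ⁻¹' K from hz)]
    have hε : ∀ ε > 0, Filter.limsup (fun k : ℕ => ENNReal.ofReal (k + 2) *
        volume.restrict K (levelGap u x₀ r (1 / (k + 1)) z)) Filter.atTop
          ≤ ENNReal.ofReal (2 * (r * ‖D‖ + ε * M)) := by
      intro ε hε
      have hG : Filter.Tendsto (fun k : ℕ => ENNReal.ofReal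
          ((1 + 1 / ((k : ℝ) + 1)) * (2 * (r * ‖D‖ + ε * M)))) Filter.atTop
          (nhds (ENNReal.ofReal (2 * (r * ‖D‖ + ε * M)))) := by
        refine ENNReal.tendsto_ofReal ?_
        simpa using (hτ.const_add 1).mul_const (2 * (r * ‖D‖ + ε * M))
      rw [← hG.limsup_eq]
      refine Filter.limsup_le_limsup ?_
      filter_upwards [key ε hε] with k hk
      calc _ ≤ ENNReal.ofReal (k + 2) * volume (Icc
              (u z + 1 / (k + 1) * D (z - x₀) - 1 / (k + 1) * (r * ‖D‖ + ε * M))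
              (u z + 1 / (k + 1) * D (z - x₀) + 1 / (k + 1) * (r * ‖D‖ + ε * M))) := by
            exact mul_le_mul_right ((Measure.restrict_apply_le _ _).trans (measure_mono hk)) _
        _ = _ := by
            rw [Real.volume_Icc, ← ENNReal.ofReal_mul (by positivity)]
            congr 1
            field_simp
            ring
    have hlim : Filter.Tendsto (fun ε : ℝ => ENNReal.ofReal (2 * (r * ‖D‖ + ε * M)))
        (nhdsWithin 0 (Ioi 0)) (nhds (ENNReal.ofReal (2 * (r * ‖D‖ + 0 * M)))) := by
      refine ENNReal.tendsto_ofReal (Filter.Tendsto.mono_left ?_ nhdsWithin_le_nhds)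
      exact Continuous.tendsto (by fun_prop) 0
    have := ge_of_tendsto hlim (Filter.eventually_of_mem self_mem_nhdsWithin fun ε h => hε ε h)
    refine this.trans (le_of_eq ?_)
    rw [← ofReal_norm, ← ENNReal.ofReal_mul (by positivity)]
    congr 1
    ring

/-- A coarea-type inequality on the values in a compact set of levels. -/
lemma IsLogConcave.mul_setLIntegral_le_of_isCompact {n : ℕ} {μ : Measure (En n)}
    [IsProbabilityMeasure μ] (hlc : IsLogConcave μ) {x₀ : En n} {r : ℝ} (hr : 0 ≤ r)
    (hβ : 0 < μ.real (Metric.closedBall x₀ r)) {u : En n → ℝ} (hu : Differentiable ℝ u)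
    {L : NNReal} (hL : LipschitzWith L u) {w : ℝ} (hw0 : 0 ≤ w) {K : Set ℝ} (hK : IsCompact K)
    (hw : ∀ s ∈ K, w * μ.real {x | s < u x} ≤ Real.log (μ.real (Metric.closedBall x₀ r))
      - μ.real {x | s < u x} * Real.log (μ.real {x | s < u x})
      - (1 - μ.real {x | s < u x}) * Real.log (1 - μ.real {x | s < u x})) :
    ENNReal.ofReal w * ∫⁻ s in K, μ {x | s < u x}
      ≤ ENNReal.ofReal (2 * r) * ∫⁻ x in u ⁻¹' K, ‖fderiv ℝ u x‖ₑ ∂μ := by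
  have hKm := hK.isClosed.measurableSet
  set F : ℕ → En n → ℝ≥0∞ := fun k z => ENNReal.ofReal (k + 2) *
    volume.restrict K (levelGap u x₀ r (1 / (k + 1)) z) with hF
  have hSm : ∀ k : ℕ, MeasurableSet
      {p : En n × ℝ | p.2 ∈ levelGap u x₀ r (1 / (k + 1)) p.1} := fun k =>
    (isOpen_levelGap hu.continuous x₀ r _).measurableSet
  have hFm : ∀ k, Measurable (F k) := fun k =>
    (measurable_measure_prodMk_left (hSm k)).const_mul _
  have hFb : ∀ k z, F k z ≤ ENNReal.ofReal (4 * (L * r)) := by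
    intro k z
    have hτ0 : (0 : ℝ) ≤ 1 / (k + 1) := by positivity
    have hsub : levelGap u x₀ r (1 / (k + 1)) z ⊆
        Icc (u (z + (1 / (k + 1) : ℝ) • (z - x₀)) - L * (1 / (k + 1) * r))
          (u (z + (1 / (k + 1) : ℝ) • (z - x₀)) + L * (1 / (k + 1) * r)) := by
      refine levelGap_subset_Icc fun e he => ?_
      rw [← Real.dist_eq]
      refine (hL.dist_le_mul _ _).trans ?_
      gcongr
      rw [dist_eq_norm, show z + (1 / (k + 1) : ℝ) • (z - x₀ + e) -
        (z + (1 / (k + 1) : ℝ) • (z - x₀)) = (1 / (k + 1) : ℝ) • e by module, norm_smul,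
        Real.norm_of_nonneg hτ0]
      gcongr
    refine (mul_le_mul_right ((Measure.restrict_apply_le _ _).trans (measure_mono hsub)) _).trans ?_
    rw [Real.volume_Icc, ← ENNReal.ofReal_mul (by positivity)]
    refine ENNReal.ofReal_le_ofReal ?_
    have h1 : (1 : ℝ) / (k + 1) ≤ 1 := by
      rw [div_le_one (by positivity)]; linarith [(k.cast_nonneg : (0 : ℝ) ≤ k)]
    have h2 : 0 ≤ L * r := by positivity
    have h3 : ((k : ℝ) + 2) * (1 / (k + 1)) = 1 + 1 / (k + 1) := by field_simp; ring
    calc _ = 2 * (L * r) * (((k : ℝ) + 2) * (1 / (k + 1))) := by ring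
      _ ≤ 4 * (L * r) := by rw [h3]; nlinarith
  have hFl : ∀ k, ENNReal.ofReal w * ∫⁻ s in K, μ {x | s < u x} ≤ ∫⁻ z, F k z ∂μ := by
    intro k
    have e1 : ∫⁻ z, F k z ∂μ = ∫⁻ s in K, ENNReal.ofReal (k + 2) *
        μ {z | s ∈ levelGap u x₀ r (1 / (k + 1)) z} := by
      have h1 := Measure.prod_apply (μ := μ) (ν := volume.restrict K) (hSm k)
      have h2 := Measure.prod_apply_symm (μ := μ) (ν := volume.restrict K) (hSm k)
      have h3 := lintegral_const_mul (μ := μ) (ENNReal.ofReal (k + 2))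
        (measurable_measure_prodMk_left (ν := volume.restrict K) (hSm k))
      have h4 := lintegral_const_mul (μ := volume.restrict K) (ENNReal.ofReal (k + 2))
        (measurable_measure_prodMk_right (μ := μ) (hSm k))
      exact (h3.trans (congrArg _ (h1.symm.trans h2))).trans h4.symm
    have hanti : Antitone fun s : ℝ => μ {x | s < u x} :=
      fun s s' h => measure_mono fun x hx => lt_of_le_of_lt h hx
    rw [e1, ← lintegral_const_mul _ hanti.measurable]
    refine lintegral_mono_ae ?_
    have hnull : ∀ᵐ s ∂(volume.restrict K), μ {x | u x = s} = 0 := by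
      refine ae_restrict_of_ae ?_
      have hc := Measure.countable_meas_level_set_pos (μ := μ) hu.continuous.measurable
      filter_upwards [measure_eq_zero_iff_ae_notMem.1 (hc.measure_zero volume)] with s hs
      exact not_not.1 fun h => hs (pos_iff_ne_zero.2 h)
    filter_upwards [hnull, ae_restrict_mem hKm] with s hs hsK
    have hτ : (0 : ℝ) < 1 / (k + 1) := by positivity
    have key := hlc.ofReal_le_measure_levelGap hβ hu.continuous hs hτ
    have e2 : (1 / ((k : ℝ) + 1)) / (1 + 1 / (k + 1)) = 1 / (k + 2) := by
      field_simp
      ring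
    rw [e2] at key
    have key2 : w * μ.real {x | s < u x}
        ≤ (k + 2) * μ.real {z | s ∈ levelGap u x₀ r (1 / (k + 1)) z} := by
      refine (hw s hsK).trans ?_
      rwa [div_mul_eq_mul_div, one_mul, div_le_iff₀' (by positivity)] at key
    rw [← ofReal_measureReal (μ := μ) (s := {x | s < u x}),
      ← ofReal_measureReal (μ := μ) (s := {z | s ∈ levelGap u x₀ r (1 / (k + 1)) z}),
      ← ENNReal.ofReal_mul hw0, ← ENNReal.ofReal_mul (by positivity)]
    exact ENNReal.ofReal_le_ofReal key2
  have hDm : Measurable fun x => ‖fderiv ℝ u x‖ₑ := (measurable_fderiv ℝ u).enorm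
  calc ENNReal.ofReal w * ∫⁻ s in K, μ {x | s < u x}
      ≤ Filter.limsup (fun k => ∫⁻ z, F k z ∂μ) Filter.atTop :=
        Filter.le_limsup_of_frequently_le (Filter.Frequently.of_forall hFl) (by isBoundedDefault)
    _ ≤ ∫⁻ z, Filter.limsup (fun k => F k z) Filter.atTop ∂μ :=
        limsup_lintegral_le (fun _ => ENNReal.ofReal (4 * (L * r))) hFm
          (fun k => Filter.Eventually.of_forall (hFb k))
          (by rw [lintegral_const, measure_univ, mul_one]; exact ENNReal.ofReal_ne_top)
    _ ≤ ∫⁻ z, (u ⁻¹' K).indicator (fun z => ENNReal.ofReal (2 * r) * ‖fderiv ℝ u z‖ₑ) z ∂μ :=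
        lintegral_mono fun z => limsup_volume_levelGap_le hr (hu z) hK.isClosed
    _ = _ := by
        rw [lintegral_indicator (hu.continuous.measurable hKm), lintegral_const_mul _ hDm]

/-- A coarea-type inequality on the values in a measurable set of positive levels. -/
lemma IsLogConcave.mul_setLIntegral_le {n : ℕ} {μ : Measure (En n)}
    [IsProbabilityMeasure μ] (hlc : IsLogConcave μ) {x₀ : En n} {r : ℝ} (hr : 0 ≤ r)
    (hβ : 0 < μ.real (Metric.closedBall x₀ r)) {u : En n → ℝ} (hu : Differentiable ℝ u)
    {L : NNReal} (hL : LipschitzWith L u) {w : ℝ} (hw0 : 0 ≤ w) {E : Set ℝ} (hE : MeasurableSet E)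
    (hfin : ∫⁻ s in E, μ {x | s < u x} ≠ ∞)
    (hw : ∀ s ∈ E, w * μ.real {x | s < u x} ≤ Real.log (μ.real (Metric.closedBall x₀ r))
      - μ.real {x | s < u x} * Real.log (μ.real {x | s < u x})
      - (1 - μ.real {x | s < u x}) * Real.log (1 - μ.real {x | s < u x})) :
    ENNReal.ofReal w * ∫⁻ s in E, μ {x | s < u x}
      ≤ ENNReal.ofReal (2 * r) * ∫⁻ x in u ⁻¹' E, ‖fderiv ℝ u x‖ₑ ∂μ := by
  set ν := (volume.restrict E).withDensity fun s => μ {x | s < u x} with hν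
  have : IsFiniteMeasure ν := isFiniteMeasure_withDensity hfin
  have hνE : ∀ K ⊆ E, MeasurableSet K → ν K = ∫⁻ s in K, μ {x | s < u x} := by
    intro K hKE hK
    rw [hν, withDensity_apply _ hK, Measure.restrict_restrict hK, inter_eq_self_of_subset_left hKE]
  rw [← hνE E Subset.rfl hE, hE.measure_eq_iSup_isCompact_of_ne_top (measure_ne_top ν E)]
  simp only [ENNReal.mul_iSup]
  refine iSup_le fun K => iSup_le fun hKE => iSup_le fun hK => ?_
  rw [hνE K hKE hK.isClosed.measurableSet]
  refine (hlc.mul_setLIntegral_le_of_isCompact hr hβ hu hL hw0 hK fun s hs => hw s (hKE hs)).trans ?_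
  exact mul_le_mul_right (lintegral_mono_set (preimage_mono hKE)) _

lemma mul_le_log_sub_entropy {a β : ℝ} {j : ℕ} (ha1 : (1 / 3) ^ (j + 1) < a) (ha2 : a ≤ (1 / 3) ^ j)
    (ha3 : a ≤ 1 / 2) (hβ : 1 - 1 / 4 * (1 / 3) ^ (j + 1) ≤ β) :
    (2 * j + 3) / 5 * a ≤ Real.log β - a * Real.log a - (1 - a) * Real.log (1 - a) := by
  have ha : 0 < a := lt_trans (by positivity) ha1
  have hβ0 : 1 - a / 4 ≤ β := by linarith
  have hβ1 : 0 < β := by linarith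
  have h1 : -(a / 2) ≤ Real.log β := by
    refine le_trans ?_ (Real.one_sub_inv_le_log_of_pos hβ1)
    have : β⁻¹ ≤ 1 + a / 2 := by
      rw [inv_le_comm₀ hβ1 (by positivity)]
      refine le_trans ?_ hβ0
      rw [inv_eq_one_div, div_le_iff₀ (by positivity)]
      nlinarith
    linarith
  have h2 : a / 2 ≤ -((1 - a) * Real.log (1 - a)) := by
    have := Real.log_le_sub_one_of_pos (show 0 < 1 - a by linarith)
    nlinarith
  have h3 : ((2 * j + 3) / 5 : ℝ) ≤ -Real.log a := by
    rcases Nat.eq_zero_or_pos j with rfl | hj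
    · have := Real.log_le_log ha ha3
      rw [one_div, Real.log_inv] at this
      norm_num
      linarith [Real.log_two_gt_d9]
    · have := Real.log_le_log ha ha2
      rw [Real.log_pow, one_div, Real.log_inv] at this
      have h3 : 1 ≤ Real.log 3 := by
        rw [Real.le_log_iff_exp_le (by norm_num)]
        linarith [Real.exp_one_lt_d9]
      have hj' : (1 : ℝ) ≤ j := by exact_mod_cast hj
      nlinarith
  nlinarith

/-- The functional Cheeger inequality for functions vanishing on at least half of the space. -/
lemma IsLogConcave.lintegral_le_lintegral_fderiv {n : ℕ} {μ : Measure (En n)}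
    [IsProbabilityMeasure μ] (hlc : IsLogConcave μ) {x₀ : En n} {r : ℝ} (hr0 : 0 ≤ r)
    (hr : μ.real {x | r < dist x x₀} ≤ 1 / 4) {u : En n → ℝ} (hu : Differentiable ℝ u)
    {L : NNReal} (hL : LipschitzWith L u) (hu0 : ∀ x, 0 ≤ u x)
    (hfin : ∫⁻ x, ENNReal.ofReal (u x) ∂μ ≠ ∞) (hhalf : μ.real {x | 0 < u x} ≤ 1 / 2) :
    ∫⁻ x, ENNReal.ofReal (u x) ∂μ ≤ ENNReal.ofReal (10 * r) * ∫⁻ x, ‖fderiv ℝ u x‖ₑ ∂μ := by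
  set a : ℝ → ℝ := fun s => μ.real {x | s < u x} with ha
  have hanti : Antitone a := fun s s' h =>
    measureReal_mono fun x hx => lt_of_le_of_lt h hx
  set E : ℕ → Set ℝ := fun j => Ioi 0 ∩ a ⁻¹' Ioc ((1 / 3) ^ (j + 1)) ((1 / 3) ^ j) with hE
  have hEm : ∀ j, MeasurableSet (E j) := fun j =>
    measurableSet_Ioi.inter (hanti.measurable measurableSet_Ioc)
  have hlayer : ∫⁻ x, ENNReal.ofReal (u x) ∂μ = ∫⁻ s in Ioi (0 : ℝ), μ {x | s < u x} :=
    lintegral_eq_lintegral_meas_lt μ (Filter.Eventually.of_forall hu0)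
      hu.continuous.measurable.aemeasurable
  have hdisj : Pairwise (Function.onFun Disjoint fun j => u ⁻¹' E j) := by
    intro i j hij
    have h1 : Antitone fun j : ℕ => (1 / 3 : ℝ) ^ j :=
      pow_right_anti₀ (by norm_num) (by norm_num)
    have h2 := h1.pairwise_disjoint_on_Ioc_succ hij
    exact ((h2.preimage a).mono inter_subset_right inter_subset_right).preimage u
  have hpiece : ∀ j, ∫⁻ s in E j, μ {x | s < u x}
      ≤ ENNReal.ofReal (10 * r) * ∫⁻ x in u ⁻¹' E j, ‖fderiv ℝ u x‖ₑ ∂μ := by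
    intro j
    have hβ : 1 - 1 / 4 * (1 / 3) ^ (j + 1) ≤ μ.real (Metric.closedBall x₀ ((2 * j + 3) * r)) := by
      have h1 := hlc.measure_lt_dist_le hr j
      have h2 : {x : En n | (2 * j + 3) * r < dist x x₀}
          = (Metric.closedBall x₀ ((2 * j + 3) * r))ᶜ := by
        ext x; simp
      rw [h2, probReal_compl_eq_one_sub Metric.isClosed_closedBall.measurableSet] at h1
      linarith
    have hβ0 : 0 < μ.real (Metric.closedBall x₀ ((2 * j + 3) * r)) := by
      have : (1 / 3 : ℝ) ^ (j + 1) ≤ 1 := pow_le_one₀ (by norm_num) (by norm_num)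
      linarith
    have hw : (0 : ℝ) < (2 * j + 3) / 5 := by positivity
    have key := hlc.mul_setLIntegral_le (w := (2 * j + 3) / 5) (by positivity) hβ0 hu hL
      hw.le (hEm j) (ne_top_of_le_ne_top (hlayer ▸ hfin) (lintegral_mono_set inter_subset_left))
      fun s hs => mul_le_log_sub_entropy hs.2.1 hs.2.2
        ((hanti (le_of_lt hs.1)).trans hhalf) hβ
    rw [show 2 * ((2 * j + 3) * r) = (2 * j + 3) / 5 * (10 * r) by ring, ENNReal.ofReal_mul hw.le,
      mul_assoc] at key
    exact (ENNReal.mul_le_mul_iff_right (ENNReal.ofReal_pos.2 hw).ne' ENNReal.ofReal_ne_top).1 key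
  calc ∫⁻ x, ENNReal.ofReal (u x) ∂μ = ∫⁻ s in Ioi (0 : ℝ), μ {x | s < u x} := hlayer
    _ = ∫⁻ s in Ioi (0 : ℝ), (⋃ j, E j).indicator (fun s => μ {x | s < u x}) s := by
        refine setLIntegral_congr_fun measurableSet_Ioi fun s hs => ?_
        by_cases h : s ∈ ⋃ j, E j
        · simp only [indicator_of_mem h]
        · simp only [indicator_of_notMem h]
          by_contra hne
          have has : 0 < a s := ENNReal.toReal_pos hne (measure_ne_top _ _)
          obtain ⟨j, hj⟩ := exists_nat_pow_near_of_lt_one has measureReal_le_one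
            (show (0 : ℝ) < 1 / 3 by norm_num) (by norm_num)
          exact h (mem_iUnion.2 ⟨j, hs, hj⟩)
    _ = ∫⁻ s in ⋃ j, E j, μ {x | s < u x} := by
        rw [lintegral_indicator (MeasurableSet.iUnion hEm),
          Measure.restrict_restrict (MeasurableSet.iUnion hEm),
          inter_eq_self_of_subset_left (iUnion_subset fun j => inter_subset_left)]
    _ ≤ ∑' j, ∫⁻ s in E j, μ {x | s < u x} := lintegral_iUnion_le _ _
    _ ≤ ∑' j, ENNReal.ofReal (10 * r) * ∫⁻ x in u ⁻¹' E j, ‖fderiv ℝ u x‖ₑ ∂μ :=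
        ENNReal.tsum_le_tsum hpiece
    _ = ENNReal.ofReal (10 * r) * ∫⁻ x in ⋃ j, u ⁻¹' E j, ‖fderiv ℝ u x‖ₑ ∂μ := by
        rw [ENNReal.tsum_mul_left,
          lintegral_iUnion (fun j => hu.continuous.measurable (hEm j)) hdisj]
    _ ≤ _ := mul_le_mul_right (setLIntegral_le_lintegral _ _) _

lemma hasDerivAt_max_zero_sq (t : ℝ) :
    HasDerivAt (fun t : ℝ => max t 0 ^ 2) (2 * max t 0) t := by
  refine hasDerivAt_of_hasDerivAt_of_ne' (f := fun t : ℝ => max t 0 ^ 2)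
    (g := fun t : ℝ => 2 * max t 0) (x := 0) (fun y hy => ?_) (by fun_prop) (by fun_prop) t
  rcases lt_or_gt_of_ne hy with h | h
  · refine HasDerivAt.congr_of_eventuallyEq (f := fun _ => 0) ?_ ?_
    · simpa [max_eq_right h.le] using hasDerivAt_const y (0 : ℝ)
    · filter_upwards [Iio_mem_nhds h] with z hz
      simp [max_eq_right (le_of_lt (mem_Iio.1 hz))]
  · refine HasDerivAt.congr_of_eventuallyEq (f := fun z => z ^ 2) ?_ ?_
    · simpa [max_eq_left h.le] using hasDerivAt_pow 2 y
    · filter_upwards [Ioi_mem_nhds h] with z hz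
      simp [max_eq_left (le_of_lt (mem_Ioi.1 hz))]

/-- The functional Cheeger inequality applied to the square of a positive part. -/
lemma IsLogConcave.integral_max_zero_sq_le {n : ℕ} {μ : Measure (En n)}
    [IsProbabilityMeasure μ] (hlc : IsLogConcave μ) {x₀ : En n} {r : ℝ} (hr0 : 0 ≤ r)
    (hr : μ.real {x | r < dist x x₀} ≤ 1 / 4) {g : En n → ℝ} (hg : Differentiable ℝ g)
    {L : NNReal} (hL : LipschitzWith L g) {B : NNReal} (hB : ∀ x, |g x| ≤ B)
    (hhalf : μ.real {x | 0 < g x} ≤ 1 / 2) :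
    ∫ x, max (g x) 0 ^ 2 ∂μ ≤ 20 * r * ∫ x, max (g x) 0 * ‖fderiv ℝ g x‖ ∂μ := by
  have hd : ∀ x, HasFDerivAt (fun x => max (g x) 0 ^ 2) ((2 * max (g x) 0) • fderiv ℝ g x) x :=
    fun x => (hasDerivAt_max_zero_sq (g x)).comp_hasFDerivAt x (hg x).hasFDerivAt
  have hnorm : ∀ x, ‖fderiv ℝ (fun x => max (g x) 0 ^ 2) x‖
      = 2 * (max (g x) 0 * ‖fderiv ℝ g x‖) := fun x => by
    rw [(hd x).fderiv, norm_smul, Real.norm_of_nonneg (by positivity), mul_assoc]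
  have hgB : ∀ x, max (g x) 0 ≤ B := fun x => max_le ((le_abs_self _).trans (hB x)) B.2
  have hDL : ∀ x, ‖fderiv ℝ g x‖ ≤ L := fun x => norm_fderiv_le_of_lipschitz ℝ hL
  have hLip : LipschitzWith (2 * (B * L)) fun x => max (g x) 0 ^ 2 := by
    refine lipschitzWith_of_nnnorm_fderiv_le (𝕜 := ℝ) (fun x => (hd x).differentiableAt) fun x => ?_
    rw [← NNReal.coe_le_coe, coe_nnnorm, hnorm]
    push_cast
    gcongr
    · exact hgB x
    · exact hDL x
  have hmg : Measurable fun x => max (g x) 0 := (hg.continuous.max continuous_const).measurable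
  have hi1 : Integrable (fun x => max (g x) 0 ^ 2) μ := by
    refine Integrable.of_bound (hmg.pow_const 2).aestronglyMeasurable (B ^ 2)
      (Filter.Eventually.of_forall fun x => ?_)
    rw [Real.norm_of_nonneg (by positivity)]
    gcongr
    exact hgB x
  have hi2 : Integrable (fun x => max (g x) 0 * ‖fderiv ℝ g x‖) μ := by
    refine Integrable.of_bound (hmg.mul (measurable_fderiv ℝ g).norm).aestronglyMeasurable (B * L)
      (Filter.Eventually.of_forall fun x => ?_)
    rw [Real.norm_of_nonneg (by positivity)]
    gcongr
    · exact hgB x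
    · exact hDL x
  have hset : {x | 0 < max (g x) 0 ^ 2} = {x | 0 < g x} := by
    ext x
    simp [sq_pos_iff]
  have key := hlc.lintegral_le_lintegral_fderiv hr0 hr (fun x => (hd x).differentiableAt) hLip
    (fun x => by positivity) hi1.lintegral_lt_top.ne (hset ▸ hhalf)
  have e1 : ∫⁻ x, ‖fderiv ℝ (fun x => max (g x) 0 ^ 2) x‖ₑ ∂μ
      = ENNReal.ofReal (2 * ∫ x, max (g x) 0 * ‖fderiv ℝ g x‖ ∂μ) := by
    rw [← integral_const_mul, ofReal_integral_eq_lintegral_ofReal (hi2.const_mul 2)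
      (Filter.Eventually.of_forall fun x => by positivity)]
    refine lintegral_congr fun x => ?_
    rw [← ofReal_norm, hnorm]
  have hI : 0 ≤ ∫ x, max (g x) 0 * ‖fderiv ℝ g x‖ ∂μ := integral_nonneg fun x => by positivity
  rw [← ofReal_integral_eq_lintegral_ofReal hi1 (Filter.Eventually.of_forall fun x => by positivity),
    e1, ← ENNReal.ofReal_mul (by positivity), ENNReal.ofReal_le_ofReal_iff (by positivity)] at key
  linarith

lemma exists_measureReal_lt_le_half {α : Type*} [MeasurableSpace α] (μ : Measure α)
    [IsProbabilityMeasure μ] {f : α → ℝ} (hf : Measurable f) {M : ℝ} (hM : ∀ x, |f x| ≤ M) :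
    ∃ m, |m| ≤ M ∧ μ.real {x | m < f x} ≤ 1 / 2 ∧ μ.real {x | f x < m} ≤ 1 / 2 := by
  set S : Set ℝ := {s | μ.real {x | s < f x} ≤ 1 / 2} with hS
  have hMS : M ∈ S := by
    have : {x | M < f x} = ∅ := by
      ext x
      simpa using (le_abs_self _).trans (hM x)
    simp [hS, this]
  have hlow : ∀ s ∈ S, -M ≤ s := by
    intro s hs
    by_contra! h
    have : {x | s < f x} = univ := by
      ext x
      simpa using h.trans_le (abs_le.1 (hM x)).1
    rw [hS, Set.mem_ofPred_eq, this, probReal_univ] at hs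
    norm_num at hs
  have hbdd : BddBelow S := ⟨-M, hlow⟩
  refine ⟨sInf S, abs_le.2 ⟨le_csInf ⟨M, hMS⟩ hlow, csInf_le hbdd hMS⟩, ?_, ?_⟩
  · have hU : {x | sInf S < f x} = ⋃ k : ℕ, {x | sInf S + 1 / (k + 1) < f x} := by
      ext x
      simp only [mem_iUnion, Set.mem_ofPred_eq]
      constructor
      · intro h
        obtain ⟨k, hk⟩ := exists_nat_one_div_lt (sub_pos.2 h)
        exact ⟨k, by linarith⟩
      · rintro ⟨k, hk⟩
        have : (0 : ℝ) < 1 / (k + 1) := by positivity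
        linarith
    have hmono : Monotone fun k : ℕ => {x | sInf S + 1 / (k + 1) < f x} := by
      intro k l hkl x hx
      refine lt_of_le_of_lt (b := sInf S + 1 / ((k : ℝ) + 1)) ?_ hx
      gcongr
    have ht := (ENNReal.tendsto_toReal (measure_ne_top μ _)).comp
      (tendsto_measure_iUnion_atTop (μ := μ) hmono)
    rw [hU]
    refine le_of_tendsto' ht fun k => ?_
    have hk : (0 : ℝ) < 1 / (k + 1) := by positivity
    obtain ⟨s, hs, hsk⟩ := exists_lt_of_csInf_lt ⟨M, hMS⟩ (lt_add_of_pos_right (sInf S) hk)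
    exact (measureReal_mono fun x hx => hsk.trans hx).trans hs
  · have hU : {x | f x < sInf S} = ⋃ k : ℕ, {x | f x ≤ sInf S - 1 / (k + 1)} := by
      ext x
      simp only [mem_iUnion, Set.mem_ofPred_eq]
      constructor
      · intro h
        obtain ⟨k, hk⟩ := exists_nat_one_div_lt (sub_pos.2 h)
        exact ⟨k, by linarith⟩
      · rintro ⟨k, hk⟩
        have : (0 : ℝ) < 1 / (k + 1) := by positivity
        linarith
    have hmono : Monotone fun k : ℕ => {x | f x ≤ sInf S - 1 / (k + 1)} := by
      intro k l hkl x hx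
      refine le_trans (b := sInf S - 1 / ((k : ℝ) + 1)) hx ?_
      gcongr
    have ht := (ENNReal.tendsto_toReal (measure_ne_top μ _)).comp
      (tendsto_measure_iUnion_atTop (μ := μ) hmono)
    rw [hU]
    refine le_of_tendsto' ht fun k => ?_
    have hk : (0 : ℝ) < 1 / (k + 1) := by positivity
    have hs : sInf S - 1 / (k + 1) ∉ S := fun h => by linarith [csInf_le hbdd h]
    replace hs : 1 / 2 < μ.real {x | sInf S - 1 / (k + 1) < f x} := not_le.1 hs
    have hc : {x | f x ≤ sInf S - 1 / (k + 1)} = {x | sInf S - 1 / (k + 1) < f x}ᶜ := by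
      ext x
      simp
    change μ.real {x | f x ≤ sInf S - 1 / (k + 1)} ≤ _
    rw [hc, probReal_compl_eq_one_sub (measurableSet_lt measurable_const hf)]
    linarith

/-- A Poincaré inequality in terms of the radius of a ball containing three quarters of the
mass. -/
lemma IsLogConcave.integral_sq_sub_sq_integral_le {n : ℕ} {μ : Measure (En n)}
    [IsProbabilityMeasure μ] (hlc : IsLogConcave μ) {x₀ : En n} {r : ℝ} (hr0 : 0 ≤ r)
    (hr : μ.real {x | r < dist x x₀} ≤ 1 / 4) {f : En n → ℝ} (hf : Differentiable ℝ f)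
    {L : NNReal} (hL : LipschitzWith L f) {M : ℝ} (hM : ∀ x, |f x| ≤ M) :
    (∫ x, f x ^ 2 ∂μ) - (∫ x, f x ∂μ) ^ 2 ≤ 400 * r ^ 2 * ∫ x, ‖fderiv ℝ f x‖ ^ 2 ∂μ := by
  have hM0 : 0 ≤ M := (abs_nonneg _).trans (hM 0)
  obtain ⟨m, hmM, hm1, hm2⟩ := exists_measureReal_lt_le_half μ hf.continuous.measurable hM
  have hmf := hf.continuous.measurable
  have hDm : Measurable fun x => ‖fderiv ℝ f x‖ := (measurable_fderiv ℝ f).norm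
  have hDL : ∀ x, ‖fderiv ℝ f x‖ ≤ L := fun x => norm_fderiv_le_of_lipschitz ℝ hL
  have hB1 : ∀ x, |f x - m| ≤ 2 * M := fun x =>
    (abs_sub _ _).trans (by linarith [hM x])
  have hB2 : ∀ x, |m - f x| ≤ 2 * M := fun x => abs_sub_comm m (f x) ▸ hB1 x
  have hD1 : ∀ x, ‖fderiv ℝ (fun x => f x - m) x‖ = ‖fderiv ℝ f x‖ := fun x => by
    rw [fderiv_sub_const]
  have hD2 : ∀ x, ‖fderiv ℝ (fun x => m - f x) x‖ = ‖fderiv ℝ f x‖ := fun x => by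
    rw [fderiv_const_sub, norm_neg]
  have h1 := hlc.integral_max_zero_sq_le hr0 hr (g := fun x => f x - m) (hf.sub_const m)
    (L := L) (by simpa using hL.sub (LipschitzWith.const m)) (B := ⟨2 * M, by positivity⟩) hB1
    (by simpa only [sub_pos] using hm1)
  have h2 := hlc.integral_max_zero_sq_le hr0 hr (g := fun x => m - f x) (hf.const_sub m)
    (L := L) (by simpa using (LipschitzWith.const m).sub hL) (B := ⟨2 * M, by positivity⟩) hB2
    (by simpa only [sub_pos] using hm2)
  simp only [hD1] at h1
  simp only [hD2] at h2
  have hbdd : ∀ {h : En n → ℝ} (C : ℝ), Measurable h → (∀ x, |h x| ≤ C) → Integrable h μ :=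
    fun C hh hC => Integrable.of_bound hh.aestronglyMeasurable C (Filter.Eventually.of_forall hC)
  have hmax : ∀ t : ℝ, |max t 0| ≤ |t| := fun t => by
    rw [abs_of_nonneg (le_max_right t 0)]
    exact max_le (le_abs_self t) (abs_nonneg t)
  have hif : Integrable f μ := hbdd M hmf hM
  have hif2 : Integrable (fun x => f x ^ 2) μ := hbdd (M ^ 2) (hmf.pow_const 2) fun x => by
    rw [abs_pow]
    exact pow_le_pow_left₀ (abs_nonneg _) (hM x) 2
  have hiD2 : Integrable (fun x => ‖fderiv ℝ f x‖ ^ 2) μ :=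
    hbdd (L ^ 2) (hDm.pow_const 2) fun x => by
      rw [abs_pow, abs_norm]
      exact pow_le_pow_left₀ (norm_nonneg _) (hDL x) 2
  have hisq : ∀ {h : En n → ℝ}, Measurable h → (∀ x, |h x| ≤ 2 * M) →
      Integrable (fun x => h x ^ 2) μ := fun hh hC =>
    hbdd ((2 * M) ^ 2) (hh.pow_const 2) fun x => by
      rw [abs_pow]
      exact pow_le_pow_left₀ (abs_nonneg _) (hC x) 2
  have hip : ∀ {h : En n → ℝ}, Measurable h → (∀ x, |h x| ≤ 2 * M) →
      Integrable (fun x => h x * ‖fderiv ℝ f x‖) μ := fun hh hC =>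
    hbdd (2 * M * L) (hh.mul hDm) fun x => by
      rw [abs_mul, abs_norm]
      exact mul_le_mul (hC x) (hDL x) (norm_nonneg _) (by positivity)
  have hmp : Measurable fun x => max (f x - m) 0 := (hmf.sub_const m).max measurable_const
  have hmn : Measurable fun x => max (m - f x) 0 := (hmf.const_sub m).max measurable_const
  have hbp : ∀ x, |max (f x - m) 0| ≤ 2 * M := fun x => (hmax _).trans (hB1 x)
  have hbn : ∀ x, |max (m - f x) 0| ≤ 2 * M := fun x => (hmax _).trans (hB2 x)
  have hsum := add_le_add h1 h2
  rw [← mul_add, ← integral_add (hisq hmp hbp) (hisq hmn hbn),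
    ← integral_add (hip hmp hbp) (hip hmn hbn), ← integral_const_mul] at hsum
  have hiS : Integrable (fun x => max (f x - m) 0 ^ 2 + max (m - f x) 0 ^ 2) μ :=
    (hisq hmp hbp).add (hisq hmn hbn)
  have hyoung : ∫ x, 20 * r * (max (f x - m) 0 * ‖fderiv ℝ f x‖
        + max (m - f x) 0 * ‖fderiv ℝ f x‖) ∂μ
      ≤ ∫ x, (1 / 2 * (max (f x - m) 0 ^ 2 + max (m - f x) 0 ^ 2)
        + 200 * r ^ 2 * ‖fderiv ℝ f x‖ ^ 2) ∂μ := by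
    refine integral_mono (((hip hmp hbp).add (hip hmn hbn)).const_mul _)
      ((hiS.const_mul _).add (hiD2.const_mul _)) fun x => ?_
    rcases le_total (f x) m with h | h
    · simp only [max_eq_right (sub_nonpos.2 h), max_eq_left (sub_nonneg.2 h)]
      nlinarith [sq_nonneg (m - f x - 20 * r * ‖fderiv ℝ f x‖)]
    · simp only [max_eq_right (sub_nonpos.2 h), max_eq_left (sub_nonneg.2 h)]
      nlinarith [sq_nonneg (f x - m - 20 * r * ‖fderiv ℝ f x‖)]
  replace hyoung := hsum.trans hyoung
  rw [integral_add (hiS.const_mul _) (hiD2.const_mul _),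
    integral_const_mul, integral_const_mul] at hyoung
  have hsq : ∀ x, max (f x - m) 0 ^ 2 + max (m - f x) 0 ^ 2 = f x ^ 2 - 2 * m * f x + m ^ 2 := by
    intro x
    rcases le_total (f x) m with h | h
    · rw [max_eq_right (sub_nonpos.2 h), max_eq_left (sub_nonneg.2 h)]
      ring
    · rw [max_eq_right (sub_nonpos.2 h), max_eq_left (sub_nonneg.2 h)]
      ring
  simp only [hsq] at hyoung
  have hvar : ∫ x, (f x ^ 2 - 2 * m * f x + m ^ 2) ∂μ
      = (∫ x, f x ^ 2 ∂μ) - 2 * m * (∫ x, f x ∂μ) + m ^ 2 := by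
    have hi : Integrable (fun x => f x ^ 2 - 2 * m * f x) μ := hif2.sub (hif.const_mul _)
    rw [integral_add hi (integrable_const _),
      integral_sub hif2 (hif.const_mul _), integral_const_mul]
    simp
  rw [hvar] at hyoung
  nlinarith [sq_nonneg ((∫ x, f x ∂μ) - m)]

lemma norm_gradient_eq_norm_fderiv {n : ℕ} (f : En n → ℝ) (x : En n) :
    ‖gradient f x‖ = ‖fderiv ℝ f x‖ := by
  rw [gradient, LinearIsometryEquiv.norm_map]

/-- Chebyshev's inequality at twice the root mean square. -/
lemma measureReal_two_mul_sqrt_integral_sq_lt_le {α : Type*} [MeasurableSpace α] (μ : Measure α)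
    [IsProbabilityMeasure μ] {d : α → ℝ}
    (hint : Integrable (fun x => d x ^ 2) μ) :
    μ.real {x | 2 * √(∫ x, d x ^ 2 ∂μ) < d x} ≤ 1 / 4 := by
  have hd2 : ∀ x, 0 ≤ d x ^ 2 := fun x => sq_nonneg _
  have hV0 : 0 ≤ ∫ x, d x ^ 2 ∂μ := integral_nonneg hd2
  obtain ⟨V, hV⟩ : ∃ V, ∫ x, d x ^ 2 ∂μ = V := ⟨_, rfl⟩
  rw [hV] at hV0 ⊢
  rcases hV0.eq_or_lt with h0 | h0
  · have hae := (integral_eq_zero_iff_of_nonneg hd2 hint).1 (hV.trans h0.symm)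
    have : μ {x | 2 * √V < d x} = 0 := by
      rw [← h0, Real.sqrt_zero, mul_zero, measure_eq_zero_iff_ae_notMem]
      filter_upwards [hae] with x hx hx0
      exact (pow_pos hx0 2).ne' hx
    rw [measureReal_def, this]
    norm_num
  · have hc : 4 * V * μ.real {x | 4 * V ≤ d x ^ 2} ≤ ∫ x, d x ^ 2 ∂μ :=
      mul_meas_ge_le_integral_of_nonneg (Filter.Eventually.of_forall hd2) hint (4 * V)
    have hsub : μ.real {x | 2 * √V < d x} ≤ μ.real {x | 4 * V ≤ d x ^ 2} := by
      refine measureReal_mono fun x (hx : 2 * √V < d x) => ?_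
      have h2 := pow_le_pow_left₀ (mul_nonneg zero_le_two (Real.sqrt_nonneg V)) hx.le 2
      rw [mul_pow, Real.sq_sqrt hV0] at h2
      rw [Set.mem_ofPred_eq]
      linarith
    rw [hV] at hc
    nlinarith

/-- Every log-concave probability measure `μ` on ℝⁿ satisfies
`C_P(μ) ≤ 32·81·ln 2 · μ(|x - μ(x)|²)`. -/
theorem poincare_logconcave_variance_bound
    {n : ℕ} (μ : Measure (En n)) [IsProbabilityMeasure μ]
    (hlc : IsLogConcave μ) :
    PoincareLE μ (32 * 81 * Real.log 2 * ∫ x, ‖x - ∫ y, y ∂μ‖ ^ 2 ∂μ) := by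
  rintro f ⟨hf, ⟨M, hM⟩, L, hL⟩
  have hint := hlc.integrable_norm_sub_sq (∫ y, y ∂μ)
  have key := hlc.integral_sq_sub_sq_integral_le (x₀ := ∫ y, y ∂μ)
    (by positivity : 0 ≤ 2 * √(∫ x, ‖x - ∫ y, y ∂μ‖ ^ 2 ∂μ))
    (by simpa only [dist_eq_norm] using
      measureReal_two_mul_sqrt_integral_sq_lt_le μ hint) (hf.differentiable (by simp)) hL hM
  have hV : 0 ≤ ∫ x, ‖x - ∫ y, y ∂μ‖ ^ 2 ∂μ := integral_nonneg fun x => by positivity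
  rw [mul_pow, Real.sq_sqrt hV] at key
  simp only [norm_gradient_eq_norm_fderiv]
  refine key.trans (mul_le_mul_of_nonneg_right ?_ (integral_nonneg fun x => by positivity))
  nlinarith [Real.log_two_gt_d9]
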